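/- Every Poincaré set is a Birkhoff set: if a set {n_k} of positive integers is a recurrence set in the measure-theoretic sense (for every probability space (X, ℬ, m) with measure-preserving transformation T and every A ∈ ℬ with m(A) > 0 there exists k with m(T^{-n_k}A ∩ A) > 0), then it is a topological recurrence set (for every compact metric space (X, d) and continuous map f : X → X and every ε > 0 there exist x ∈ X and k with d(f^{n_k}(x), x) < ε). -/

import Mathlib

open MeasureTheory

open Filter Topology in
/-- **Krylov–Bogolyubov theorem**: a continuous self-map of a nonempty compact metrizable space
has an invariant Borel probability measure. -/
theorem exists_isProbabilityMeasure_measurePreserving {X : Type*} [TopologicalSpace X]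
    [CompactSpace X] [T2Space X] [HasOuterApproxClosed X] [Nonempty X] [MeasurableSpace X]
    [BorelSpace X] {f : X → X} (hf : Continuous f) :
    ∃ m : Measure X, IsProbabilityMeasure m ∧ MeasurePreserving f m m := by
  obtain ⟨x⟩ := ‹Nonempty X›
  let empirical (N : ℕ) : Measure X :=
    ((N + 1 : ℕ) : ENNReal)⁻¹ • ∑ k ∈ Finset.range (N + 1), Measure.dirac (f^[k] x)
  have hprob (N : ℕ) : IsProbabilityMeasure (empirical N) := by
    constructor
    simp only [empirical, Measure.smul_apply, Measure.finsetSum_apply, measure_univ,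
      Finset.sum_const, Finset.card_range, smul_eq_mul, nsmul_eq_mul, mul_one]
    exact ENNReal.inv_mul_cancel (by simp) (ENNReal.natCast_ne_top _)
  have hint (g : BoundedContinuousFunction X ℝ) (N : ℕ) :
      ∫ y, g y ∂(empirical N) = birkhoffAverage ℝ f g (N + 1) x := by
    simp only [empirical]
    rw [integral_smul_measure, integral_finsetSum_measure fun _ _ ↦ g.integrable _,
      ENNReal.toReal_inv, ENNReal.toReal_natCast]
    simp [birkhoffAverage, birkhoffSum, integral_dirac' _ _ g.continuous.stronglyMeasurable]
  let u : ℕ → ProbabilityMeasure X := fun N ↦ ⟨empirical N, hprob N⟩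
  obtain ⟨μ, -, hμ⟩ := isCompact_univ.ultrafilter_le_nhds' ((hyperfilter ℕ).map u) univ_mem
  replace hμ : Tendsto u (hyperfilter ℕ) (𝓝 μ) := hμ
  rw [ProbabilityMeasure.tendsto_iff_forall_integral_tendsto] at hμ
  simp only [u, ProbabilityMeasure.coe_mk, hint] at hμ
  refine ⟨μ, inferInstance, hf.measurable, ?_⟩
  have := Measure.isProbabilityMeasure_map (μ := (μ : Measure X)) hf.measurable.aemeasurable
  refine ext_of_forall_integral_eq_of_IsFiniteMeasure fun g ↦ ?_
  rw [integral_map hf.measurable.aemeasurable g.continuous.aestronglyMeasurable]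
  have hdiff : Tendsto (fun N : ℕ ↦ birkhoffAverage ℝ f g (N + 1) (f x)
      - birkhoffAverage ℝ f g (N + 1) x) (hyperfilter ℕ) (𝓝 0) :=
    ((tendsto_birkhoffAverage_apply_sub_birkhoffAverage' ℝ g.isBounded_range f x).comp
      (tendsto_add_atTop_nat 1)).mono_left Nat.hyperfilter_le_atTop
  have hcomp := hμ (g.compContinuous ⟨f, hf⟩)
  have hshift (N : ℕ) : birkhoffAverage ℝ f (g.compContinuous ⟨f, hf⟩) N x
      = birkhoffAverage ℝ f g N (f x) := by
    simp [birkhoffAverage, birkhoffSum, ← Function.iterate_succ_apply,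
      Function.iterate_succ_apply']
  simp only [hshift] at hcomp
  simpa [sub_eq_zero] using tendsto_nhds_unique (hcomp.sub (hμ g)) hdiff

/-- A nonzero measure on a compact pseudometric space gives positive mass to some ball of
any prescribed positive radius. -/
theorem exists_measure_ball_pos {X : Type*} [PseudoMetricSpace X] [CompactSpace X]
    [MeasurableSpace X] (m : Measure X) [NeZero m] {r : ℝ} (hr : 0 < r) :
    ∃ x, 0 < m (Metric.ball x r) := by
  by_contra! h
  obtain ⟨t, htfin, ht⟩ := Metric.totallyBounded_iff.1 (isCompact_univ (X := X)).totallyBounded r hr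
  refine NeZero.ne m (Measure.measure_univ_eq_zero.1 (measure_mono_null ht ?_))
  exact (measure_biUnion_null_iff htfin.countable).2 fun y _ ↦ nonpos_iff_eq_zero.1 (h y)

theorem stmt_4 (S : Set ℕ) (hSpos : ∀ n ∈ S, 0 < n)
    (hPoincare : ∀ (X : Type) [MeasurableSpace X] (m : Measure X),
      IsProbabilityMeasure m → ∀ T : X → X, Measurable T →
        MeasurePreserving T m m →
        ∀ A : Set X, MeasurableSet A → 0 < m A →
          ∃ n ∈ S, 0 < m (T^[n] ⁻¹' A ∩ A)) :
    ∀ (X : Type) [MetricSpace X] [CompactSpace X] [Nonempty X]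
      (f : X → X), Continuous f →
        ∀ ε : ℝ, 0 < ε → ∃ x : X, ∃ n ∈ S, dist (f^[n] x) x < ε := by
  intro X _ _ _ f hf ε hε
  borelize X
  obtain ⟨m, hm, hfm⟩ := exists_isProbabilityMeasure_measurePreserving hf
  obtain ⟨c, hc⟩ := exists_measure_ball_pos m (half_pos hε)
  obtain ⟨n, hn, hpos⟩ := hPoincare X m hm f hf.measurable hfm _ measurableSet_ball hc
  obtain ⟨x, hfx, hx⟩ := nonempty_of_measure_ne_zero hpos.ne'
  refine ⟨x, n, hn, ?_⟩
  calc dist (f^[n] x) x ≤ dist (f^[n] x) c + dist x c := dist_triangle_right _ _ _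
    _ < ε / 2 + ε / 2 := add_lt_add hfx hx
    _ = ε := add_halves ε
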